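/- Let M ∈ ℕ be a prime with M > 2, let d ∈ ℕ, let z ∈ ℤ^d be a generating vector with z_{j₀} ≢ 0 (mod M) for at least one index j₀ ∈ {1,…,d}, and let ỹ_{i,j} := (i·z_j/M) mod 1 denote the rank-1 lattice nodes for i = 0,…,M−1 and j = 1,…,d. Then the unique maximizer over Δ ∈ (0, 1/(2M)) of the quantity min{ min_{i,j} |ỹ_{i,j} − Δ| , min_{i,j} |ỹ_{i,j} − (Δ + 1/2)| } is Δ = 1/(4M); that is, at Δ = 1/(4M) this quantity equals 1/(4M), and for every Δ ∈ (0, 1/(2M)) with Δ ≠ 1/(4M) this quantity is strictly less than 1/(4M). -/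

import Mathlib

/-- Every rank-1 lattice node is an integer multiple of `1 / M`. -/
lemma fract_mul_div_eq_emod_div (M i : ℕ) (a : ℤ) :
    Int.fract ((i : ℝ) * (a : ℝ) / M) = (((i : ℤ) * a % (M : ℤ) : ℤ) : ℝ) / M := by
  have h := Int.fract_div_intCast_eq_div_intCast_mod (k := ℝ) (m := (i : ℤ) * a) (n := M)
  simpa using h

/-- If `M` is prime and `M ∤ a`, the nodes `(i a / M) mod 1` exhaust the multiples of `1 / M`
in `[0, 1)`. -/
lemma exists_fract_mul_div_eq {M : ℕ} (hM : M.Prime) {a : ℤ} (ha : ¬ (M : ℤ) ∣ a)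
    {k : ℕ} (hk : k < M) :
    ∃ i : Fin M, Int.fract (((i : ℕ) : ℝ) * (a : ℝ) / M) = (k : ℝ) / M := by
  have : Fact M.Prime := ⟨hM⟩
  have ha' : (a : ZMod M) ≠ 0 := fun h => ha ((ZMod.intCast_zmod_eq_zero_iff_dvd a M).1 h)
  refine ⟨⟨((k : ZMod M) * (a : ZMod M)⁻¹).val, ZMod.val_lt _⟩, ?_⟩
  rw [fract_mul_div_eq_emod_div]
  have hmod : ((((k : ZMod M) * (a : ZMod M)⁻¹).val : ℤ) * a) % (M : ℤ) = (k : ℤ) % M := by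
    refine (ZMod.intCast_eq_intCast_iff' _ _ M).1 ?_
    push_cast
    rw [ZMod.natCast_zmod_val, inv_mul_cancel_right₀ ha']
  rw [hmod, Int.emod_eq_of_lt (by positivity) (by exact_mod_cast hk), Int.cast_natCast]

/-- A nonzero multiple of `1 / N` has absolute value at least `1 / N`. -/
lemma one_div_le_abs_intCast_div {N : ℝ} (hN : 0 < N) {n : ℤ} (hn : n ≠ 0) :
    1 / N ≤ |(n : ℝ) / N| := by
  rw [abs_div, abs_of_pos hN]
  gcongr
  exact_mod_cast Int.one_le_abs hn

/-- For a prime lattice size `M > 2` and a generating vector `z` with `z j₀ ≢ 0 (mod M)`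
for some component `j₀`, the unique maximizer over `Δ ∈ (0, 1/(2M))` of
`min { min_{i,j} |ỹ_{i,j} − Δ|, min_{i,j} |ỹ_{i,j} − (Δ + 1/2)| }`,
where `ỹ_{i,j} = (i z_j / M) mod 1` are the rank-1 lattice nodes, is `Δ = 1/(4M)`. -/
theorem usfft_optimal_shift (M : ℕ) (hM : Nat.Prime M) (hM2 : 2 < M) (d : ℕ)
    (z : Fin d → ℤ) (j₀ : Fin d) (hz : ¬ ((M : ℤ) ∣ z j₀)) :
    min (sInf (Set.range fun p : Fin M × Fin d =>
          |Int.fract (((p.1 : ℕ) : ℝ) * ((z p.2 : ℤ) : ℝ) / M) - 1 / (4 * M)|))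
        (sInf (Set.range fun p : Fin M × Fin d =>
          |Int.fract (((p.1 : ℕ) : ℝ) * ((z p.2 : ℤ) : ℝ) / M) - (1 / (4 * M) + 1 / 2)|))
      = 1 / (4 * M) ∧
    ∀ Δ : ℝ, 0 < Δ → Δ < 1 / (2 * M) → Δ ≠ 1 / (4 * M) →
      min (sInf (Set.range fun p : Fin M × Fin d =>
            |Int.fract (((p.1 : ℕ) : ℝ) * ((z p.2 : ℤ) : ℝ) / M) - Δ|))
          (sInf (Set.range fun p : Fin M × Fin d =>
            |Int.fract (((p.1 : ℕ) : ℝ) * ((z p.2 : ℤ) : ℝ) / M) - (Δ + 1 / 2)|))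
        < 1 / (4 * M) := by
  have hMpos : (0 : ℝ) < M := by exact_mod_cast hM.pos
  have : Nonempty (Fin M × Fin d) := ⟨(⟨0, hM.pos⟩, j₀)⟩
  have sInf_le_node : ∀ (c : ℝ) (k : ℕ), k < M →
      sInf (Set.range fun p : Fin M × Fin d =>
        |Int.fract (((p.1 : ℕ) : ℝ) * ((z p.2 : ℤ) : ℝ) / M) - c|) ≤ |(k : ℝ) / M - c| := by
    intro c k hk
    obtain ⟨i, hi⟩ := exists_fract_mul_div_eq hM hz hk
    refine csInf_le ⟨0, ?_⟩ ⟨(i, j₀), by simp only [hi]⟩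
    rintro _ ⟨p, rfl⟩
    exact abs_nonneg _
  refine ⟨le_antisymm ?_ (le_min ?_ ?_), fun Δ hΔ hΔM hΔne => ?_⟩
  · refine (min_le_left _ _).trans ((sInf_le_node _ 0 hM.pos).trans_eq ?_)
    rw [Nat.cast_zero, zero_div, zero_sub, abs_neg, abs_of_pos (by positivity)]
  · refine le_csInf (Set.range_nonempty _) ?_
    rintro _ ⟨p, rfl⟩
    dsimp only
    rw [fract_mul_div_eq_emod_div]
    set k : ℤ := ((p.1 : ℕ) : ℤ) * z p.2 % (M : ℤ)
    have h := one_div_le_abs_intCast_div (N := 4 * M) (by positivity)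
      (show 4 * k - 1 ≠ 0 by omega)
    refine h.trans_eq (congrArg _ ?_)
    push_cast
    field_simp
  · refine le_csInf (Set.range_nonempty _) ?_
    rintro _ ⟨p, rfl⟩
    dsimp only
    rw [fract_mul_div_eq_emod_div]
    set k : ℤ := ((p.1 : ℕ) : ℤ) * z p.2 % (M : ℤ)
    have h := one_div_le_abs_intCast_div (N := 4 * M) (by positivity)
      (show 4 * k - 1 - 2 * (M : ℤ) ≠ 0 by omega)
    refine h.trans_eq (congrArg _ ?_)
    push_cast
    field_simp
    ring
  · rcases lt_or_gt_of_ne hΔne with hlt | hgt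
    · refine (min_le_left _ _).trans_lt ((sInf_le_node _ 0 hM.pos).trans_lt ?_)
      rwa [Nat.cast_zero, zero_div, zero_sub, abs_neg, abs_of_pos hΔ]
    · obtain ⟨m, hm⟩ := hM.odd_of_ne_two hM2.ne'
      refine (min_le_right _ _).trans_lt ((sInf_le_node _ (m + 1) (by omega)).trans_lt ?_)
      have hmM : (M : ℝ) = 2 * m + 1 := by exact_mod_cast hm
      have hnode : ((m + 1 : ℕ) : ℝ) / M = 1 / 2 + 1 / (2 * M) := by
        push_cast
        field_simp
        linarith
      have hhalf : (1 : ℝ) / (2 * M) = 1 / (4 * M) + 1 / (4 * M) := by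
        field_simp
        norm_num
      rw [hnode, abs_of_pos (by linarith)]
      linarith
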